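/- Let C > 0, x₀ ∈ ℝ, let f_n : ℝ → ℝ be locally absolutely continuous with ∫_ℝ |f_n′(x)|² dx ≤ C and |f_n(x)| ≤ 1 for all x and all n, let f : [x₀−1, x₀+1] → ℝ be continuous, and suppose f_n → f in L¹([x₀−1, x₀+1]). If f_n(x₀) ≥ 0 for all n, then f(x₀) ≥ 0. -/

import Mathlib

open MeasureTheory Filter

/-- `f` is locally absolutely continuous on ℝ with a.e. derivative `f'`:
`f'` is locally integrable and `f(b) − f(a) = ∫_a^b f'` for all `a, b`. -/
def LocAC (f f' : ℝ → ℝ) : Prop :=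
  (∀ a b : ℝ, IntervalIntegrable f' volume a b) ∧
  ∀ a b : ℝ, f b - f a = ∫ x in a..b, f' x

theorem LocAC.continuous {f f' : ℝ → ℝ} (h : LocAC f f') : Continuous f := by
  have heq : f = fun x => f 0 + ∫ t in (0 : ℝ)..x, f' t := by
    funext x
    rw [← h.2 0 x]
    ring
  rw [heq]
  exact continuous_const.add (intervalIntegral.continuous_primitive h.1 0)

/-- Upper bound on the decrease of a function with finite Dirichlet energy, with a free
parameter `t` in place of the Cauchy–Schwarz optimum. -/
theorem LocAC.sub_le_of_energy_le {f f' : ℝ → ℝ} {C a b t : ℝ} (h : LocAC f f') (hC : 0 ≤ C)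
    (hE : ∫⁻ x : ℝ, ENNReal.ofReal ((f' x) ^ 2) ≤ ENNReal.ofReal C) (hab : a ≤ b) (ht : 0 < t) :
    f a - f b ≤ t * C + (b - a) / t := by
  have hi := h.1 a b
  have hm : AEStronglyMeasurable (fun x => (f' x) ^ 2) (volume.restrict (Set.Ioc a b)) :=
    hi.1.aestronglyMeasurable.pow 2
  have hnn : 0 ≤ᵐ[volume.restrict (Set.Ioc a b)] fun x => (f' x) ^ 2 :=
    Eventually.of_forall fun x => sq_nonneg _
  have hle : ∫⁻ x in Set.Ioc a b, ENNReal.ofReal ((f' x) ^ 2) ≤ ENNReal.ofReal C :=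
    (setLIntegral_le_lintegral _ _).trans hE
  have hsq : IntegrableOn (fun x => (f' x) ^ 2) (Set.Ioc a b) :=
    ⟨hm, (hasFiniteIntegral_iff_ofReal hnn).2 (hle.trans_lt ENNReal.ofReal_lt_top)⟩
  have hsqi : IntervalIntegrable (fun x => (f' x) ^ 2) volume a b :=
    (intervalIntegrable_iff_integrableOn_Ioc_of_le hab).2 hsq
  have hsqC : ∫ x in a..b, (f' x) ^ 2 ≤ C := by
    rw [intervalIntegral.integral_of_le hab, integral_eq_lintegral_of_nonneg_ae hnn hm]
    exact ENNReal.toReal_le_of_le_ofReal hC hle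
  have hmono : ∫ x in a..b, -f' x ≤ ∫ x in a..b, (t * (f' x) ^ 2 + 1 / t) := by
    refine intervalIntegral.integral_mono_on hab hi.neg
      ((hsqi.const_mul t).add intervalIntegrable_const) fun x _ => ?_
    have h1 : t * (f' x) ^ 2 + 1 / t + f' x
        = ((t * f' x + 1 / 2) ^ 2 + 3 / 4) / t := by
      field_simp
      ring
    have h2 : 0 ≤ ((t * f' x + 1 / 2) ^ 2 + 3 / 4) / t := by positivity
    linarith
  rw [intervalIntegral.integral_neg, ← h.2 a b,
    intervalIntegral.integral_add (hsqi.const_mul t) intervalIntegrable_const,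
    intervalIntegral.integral_const_mul, intervalIntegral.integral_const, smul_eq_mul] at hmono
  have h3 := mul_le_mul_of_nonneg_left hsqC ht.le
  have h4 : (b - a) * (1 / t) = (b - a) / t := by ring
  linarith

/-- sign preservation in the limit: let `f_n : ℝ → ℝ` be locally
absolutely continuous with `∫_ℝ |f_n′|² ≤ C` and `|f_n| ≤ 1`, let
`f : [x₀−1, x₀+1] → ℝ` be continuous with `f_n → f` in `L¹([x₀−1, x₀+1])`.
If `f_n(x₀) ≥ 0` for all `n`, then `f(x₀) ≥ 0`. -/
theorem statement18 (C : ℝ) (hC : 0 < C) (x₀ : ℝ)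
    (f : ℕ → ℝ → ℝ) (f' : ℕ → ℝ → ℝ) (g : ℝ → ℝ)
    (hAC : ∀ n, LocAC (f n) (f' n))
    (hE : ∀ n, ∫⁻ x : ℝ, ENNReal.ofReal ((f' n x) ^ 2) ≤ ENNReal.ofReal C)
    (hbd : ∀ n x, |f n x| ≤ 1)
    (hg : ContinuousOn g (Set.Icc (x₀ - 1) (x₀ + 1)))
    (hL1 : Tendsto (fun n => ∫ x in Set.Icc (x₀ - 1) (x₀ + 1), |f n x - g x|) atTop
      (nhds 0))
    (hpos : ∀ n, 0 ≤ f n x₀) :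
    0 ≤ g x₀ := by
  by_contra! hneg
  obtain ⟨e, he, hge⟩ : ∃ e : ℝ, 0 < e ∧ g x₀ = -(4 * e) := ⟨-g x₀ / 4, by linarith, by ring⟩
  have hmem : x₀ ∈ Set.Icc (x₀ - 1) (x₀ + 1) := ⟨by linarith, by linarith⟩
  obtain ⟨r, hr, hgr⟩ := Metric.continuousOn_iff.1 hg x₀ hmem e he
  set t : ℝ := e / C with ht
  have htpos : 0 < t := div_pos he hC
  have htC : t * C = e := div_mul_cancel₀ e hC.ne'
  obtain ⟨d, hd, hd1, hdr, hdt⟩ : ∃ d : ℝ, 0 < d ∧ d ≤ 1 ∧ d < r ∧ d ≤ e * t := by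
    refine ⟨min 1 (min (r / 2) (e * t)), by positivity, min_le_left _ _, ?_, ?_⟩
    · exact ((min_le_right _ _).trans (min_le_left _ _)).trans_lt (by linarith)
    · exact (min_le_right _ _).trans (min_le_right _ _)
  have hsub : Set.Icc x₀ (x₀ + d) ⊆ Set.Icc (x₀ - 1) (x₀ + 1) :=
    Set.Icc_subset_Icc (by linarith) (by linarith)
  have hlow : ∀ n, e * d ≤ ∫ x in Set.Icc (x₀ - 1) (x₀ + 1), |f n x - g x| := by
    intro n
    have hint : IntegrableOn (fun x => |f n x - g x|) (Set.Icc (x₀ - 1) (x₀ + 1)) :=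
      (((hAC n).continuous.continuousOn.sub hg).abs).integrableOn_compact isCompact_Icc
    have hpt : ∀ x ∈ Set.Icc x₀ (x₀ + d), e ≤ |f n x - g x| := by
      intro x hx
      have h1 := (hAC n).sub_le_of_energy_le hC.le (hE n) hx.1 htpos
      have h2 : (x - x₀) / t ≤ e := by
        rw [div_le_iff₀ htpos]
        linarith [hx.2]
      have h3 := hgr x (hsub hx) (by
        rw [Real.dist_eq, abs_of_nonneg (by linarith [hx.1])]
        linarith [hx.2])
      rw [Real.dist_eq] at h3
      have h4 := (abs_lt.1 h3).2
      exact le_trans (by linarith [hpos n]) (le_abs_self _)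
    calc e * d = ∫ _ in Set.Icc x₀ (x₀ + d), e := by
          rw [setIntegral_const, Real.volume_real_Icc_of_le (by linarith), smul_eq_mul]
          ring
      _ ≤ ∫ x in Set.Icc x₀ (x₀ + d), |f n x - g x| :=
          setIntegral_mono_on (continuousOn_const.integrableOn_compact isCompact_Icc)
            (hint.mono_set hsub) measurableSet_Icc hpt
      _ ≤ ∫ x in Set.Icc (x₀ - 1) (x₀ + 1), |f n x - g x| :=
          setIntegral_mono_set hint (Eventually.of_forall fun x => abs_nonneg _)
            hsub.eventuallyLE
  have hlim := ge_of_tendsto' hL1 hlow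
  linarith [mul_pos he hd]
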